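/- For every α ∈ [1/4, 1/2] there exists c > 0 such that for all n ≥ 1, sup_{x∈ℝ} |H_n(x) e^{-α x²}| ≤ c √(n!) · n^{-(8α-1)/12}, where H_n is the probabilists' Hermite polynomial. -/

import Mathlib

open Polynomial

theorem derivative_hermite_succ (n : ℕ) :
    derivative (hermite (n + 1)) = (n + 1 : ℤ[X]) * hermite n := by
  induction n with
  | zero => simp
  | succ n ih =>
    rw [hermite_succ (n + 1), derivative_sub, derivative_mul, derivative_X, ih, hermite_succ n]
    simp only [derivative_mul, derivative_add, derivative_natCast, derivative_one]
    push_cast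
    ring

theorem derivative_derivative_hermite (n : ℕ) :
    derivative (derivative (hermite n)) = X * derivative (hermite n) - (n : ℤ[X]) * hermite n := by
  have h := derivative_hermite_succ n
  rw [hermite_succ, derivative_sub, derivative_mul, derivative_X] at h
  linear_combination -h

theorem aeval_zero_hermite_add_two (n : ℕ) :
    aeval (0 : ℝ) (hermite (n + 2)) = -(n + 1) * aeval (0 : ℝ) (hermite n) := by
  rw [hermite_succ (n + 1), derivative_hermite_succ]
  simp
  ring

theorem aeval_zero_hermite_pow_four_le (n : ℕ) :
    aeval (0 : ℝ) (hermite n) ^ 4 * (n + 1) ≤ (n.factorial : ℝ) ^ 2 := by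
  induction n using Nat.twoStepInduction with
  | zero => simp
  | one => simp
  | more n ih _ =>
    rw [aeval_zero_hermite_add_two, Nat.factorial_succ, Nat.factorial_succ]
    push_cast
    have hn : (0 : ℝ) ≤ n := n.cast_nonneg
    have h4 : (0 : ℝ) ≤ aeval (0 : ℝ) (hermite n) ^ 4 := by positivity
    calc (-((n : ℝ) + 1) * aeval (0 : ℝ) (hermite n)) ^ 4 * (n + 2 + 1)
        = (n + 1) ^ 2 * ((n + 1) * (n + 3)) * (aeval (0 : ℝ) (hermite n) ^ 4 * (n + 1)) := by ring
      _ ≤ (n + 1) ^ 2 * (n + 2) ^ 2 * (n.factorial : ℝ) ^ 2 := by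
          gcongr
          nlinarith
      _ = _ := by ring

theorem aeval_zero_hermite_sq_le (n : ℕ) :
    aeval (0 : ℝ) (hermite n) ^ 2 * √(n + 1) ≤ n.factorial := by
  refine le_of_sq_le_sq ?_ (Nat.cast_nonneg _)
  have h : √((n : ℝ) + 1) ^ 2 = n + 1 := Real.sq_sqrt (by positivity)
  rw [mul_pow, h, ← pow_mul]
  exact aeval_zero_hermite_pow_four_le n

theorem tendsto_eval_mul_exp_neg_sq (p : ℝ[X]) :
    Filter.Tendsto (fun x => p.eval x * Real.exp (-(x ^ 2 / 4))) Filter.atTop (nhds 0) := by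
  refine squeeze_zero_norm' ?_ (p.tendsto_div_exp_atTop.abs.trans (by simp))
  filter_upwards [Filter.eventually_ge_atTop 4] with x hx
  rw [Real.norm_eq_abs, abs_mul, Real.abs_exp, abs_div, Real.abs_exp,
    div_eq_mul_inv |_|, ← Real.exp_neg]
  gcongr
  nlinarith

theorem antitoneOn_of_hasDerivAt_nonpos {f f' : ℝ → ℝ} {s : Set ℝ} (hs : Convex ℝ s)
    (hf : ∀ x ∈ s, HasDerivAt f (f' x) x) (hf' : ∀ x ∈ s, f' x ≤ 0) : AntitoneOn f s := by
  refine antitoneOn_of_deriv_nonpos hs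
    (fun x hx => (hf x hx).continuousAt.continuousWithinAt)
    (fun x hx => (hf x (interior_subset hx)).differentiableAt.differentiableWithinAt) ?_
  intro x hx
  rw [(hf x (interior_subset hx)).deriv]
  exact hf' x (interior_subset hx)

section Weber

variable {y y' : ℝ → ℝ} {N : ℝ}

/-- The local wave number `√(N - x² / 4)` of the Weber equation `y'' = -(N - x² / 4) y`. -/
noncomputable def waveNumber (N x : ℝ) : ℝ := √(N - x ^ 2 / 4)

theorem waveNumber_sq {x : ℝ} (h : x ^ 2 / 4 ≤ N) : waveNumber N x ^ 2 = N - x ^ 2 / 4 :=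
  Real.sq_sqrt (by linarith)

theorem hasDerivAt_waveNumber {x : ℝ} (h : x ^ 2 / 4 < N) :
    HasDerivAt (waveNumber N) (-x / (4 * waveNumber N x)) x := by
  have h1 : HasDerivAt (fun x : ℝ => N - x ^ 2 / 4) (-(2 * x / 4)) x := by
    simpa using ((hasDerivAt_pow 2 x).div_const 4).const_sub N
  have h2 := h1.sqrt (by linarith)
  refine h2.congr_deriv ?_
  have : √(N - x ^ 2 / 4) ≠ 0 := (Real.sqrt_pos.2 (by linarith)).ne'
  simp only [waveNumber]
  field_simp

/-- The second derivative of the reciprocal of the wave number `s` at `x`. -/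
noncomputable def reciprocalCurvature (x s : ℝ) : ℝ := 1 / (4 * s ^ 3) + 3 * x ^ 2 / (16 * s ^ 5)

/-- The quadratic form `M y'² - M' y y' + (M'' / 2 + q M) y²` with `M = 1 / s` and `q = s²`. -/
noncomputable def weberAmplitude (x s u v : ℝ) : ℝ :=
  v ^ 2 / s - x / (4 * s ^ 3) * (u * v) + (reciprocalCurvature x s / 2 + s) * u ^ 2

theorem weberAmplitude_eq {x s u v : ℝ} (hs : s ≠ 0) :
    weberAmplitude x s u v = (v - x / (8 * s ^ 2) * u) ^ 2 / s
      + (1 / (8 * s ^ 3) + 5 * x ^ 2 / (64 * s ^ 5) + s) * u ^ 2 := by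
  unfold weberAmplitude reciprocalCurvature
  field_simp
  ring

theorem mul_sq_le_weberAmplitude {x s u v : ℝ} (hs : 0 < s) :
    s * u ^ 2 ≤ weberAmplitude x s u v := by
  rw [weberAmplitude_eq hs.ne']
  have h1 : 0 ≤ (v - x / (8 * s ^ 2) * u) ^ 2 / s := by positivity
  have h2 : 0 ≤ (1 / (8 * s ^ 3) + 5 * x ^ 2 / (64 * s ^ 5)) * u ^ 2 := by positivity
  linarith

theorem sq_div_le_weberAmplitude {x s u v : ℝ} (hs : 0 < s) :
    (v - x / (8 * s ^ 2) * u) ^ 2 / s ≤ weberAmplitude x s u v := by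
  rw [weberAmplitude_eq hs.ne']
  have h2 : 0 ≤ (1 / (8 * s ^ 3) + 5 * x ^ 2 / (64 * s ^ 5) + s) * u ^ 2 := by positivity
  linarith

theorem hasDerivAt_reciprocalCurvature {s : ℝ → ℝ} {x : ℝ} (hs : HasDerivAt s (-x / (4 * s x)) x)
    (h0 : s x ≠ 0) :
    HasDerivAt (fun x => reciprocalCurvature x (s x))
      (9 * x / (16 * s x ^ 5) + 15 * x ^ 3 / (64 * s x ^ 7)) x := by
  unfold reciprocalCurvature
  have h3 := (hasDerivAt_const x (1 : ℝ)).fun_div ((hs.fun_pow 3).const_mul 4) (by positivity)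
  have h5 := ((hasDerivAt_pow 2 x).const_mul 3).fun_div ((hs.fun_pow 5).const_mul 16)
    (by positivity)
  refine (h3.fun_add h5).congr_deriv ?_
  push_cast
  field_simp
  ring

theorem hasDerivAt_weberAmplitude {s : ℝ → ℝ} {x : ℝ} (hs : HasDerivAt s (-x / (4 * s x)) x)
    (h0 : s x ≠ 0) (hy : HasDerivAt y (y' x) x) (hy' : HasDerivAt y' (-s x ^ 2 * y x) x) :
    HasDerivAt (fun x => weberAmplitude x (s x) (y x) (y' x))
      ((9 * x / (16 * s x ^ 5) + 15 * x ^ 3 / (64 * s x ^ 7)) / 2 * y x ^ 2) x := by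
  unfold weberAmplitude
  have h1 := (hy'.fun_pow 2).fun_div hs h0
  have h2 := ((hasDerivAt_id' x).fun_div ((hs.fun_pow 3).const_mul 4) (by positivity)).fun_mul
    (hy.fun_mul hy')
  have h3 := (((hasDerivAt_reciprocalCurvature hs h0).div_const 2).fun_add hs).fun_mul
    (hy.fun_pow 2)
  refine ((h1.fun_sub h2).fun_add h3).congr_deriv ?_
  unfold reciprocalCurvature
  push_cast
  field_simp
  ring

theorem antitoneOn_weberEnergy (hy : ∀ x, HasDerivAt y (y' x) x)
    (hy' : ∀ x, HasDerivAt y' (-(N - x ^ 2 / 4) * y x) x) :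
    AntitoneOn (fun x => (N - x ^ 2 / 4) * y x ^ 2 + y' x ^ 2) (Set.Ici 0) := by
  refine antitoneOn_of_hasDerivAt_nonpos (f' := fun x => -(x / 2 * y x ^ 2)) (convex_Ici 0)
    (fun x _ => ?_) (fun x hx => ?_)
  · have h1 := (((hasDerivAt_pow 2 x).div_const 4).const_sub N).fun_mul ((hy x).fun_pow 2)
    refine (h1.fun_add ((hy' x).fun_pow 2)).congr_deriv ?_
    push_cast
    ring
  · have : 0 ≤ x := hx
    have : 0 ≤ x / 2 * y x ^ 2 := by positivity
    linarith

theorem antitoneOn_sq_of_le_sq (hy : ∀ x, HasDerivAt y (y' x) x)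
    (hy' : ∀ x, HasDerivAt y' (-(N - x ^ 2 / 4) * y x) x)
    (hlim : Filter.Tendsto y Filter.atTop (nhds 0)) {a : ℝ} (ha : 0 ≤ a) (haN : N ≤ a ^ 2 / 4) :
    AntitoneOn (fun x => y x ^ 2) (Set.Ici a) := by
  have hsq : ∀ x, HasDerivAt (fun x => y x ^ 2) (2 * (y x * y' x)) x := fun x =>
    ((hy x).fun_pow 2).congr_deriv (by push_cast; ring)
  have hmono : AntitoneOn (fun x => -(y x * y' x)) (Set.Ici a) := by
    refine antitoneOn_of_hasDerivAt_nonpos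
      (f' := fun x => -(y' x ^ 2 + (x ^ 2 / 4 - N) * y x ^ 2)) (convex_Ici a)
      (fun x _ => (((hy x).fun_mul (hy' x)).fun_neg).congr_deriv (by ring)) (fun x hx => ?_)
    have hx : a ≤ x := hx
    have h1 : 0 ≤ x ^ 2 / 4 - N := by nlinarith
    have : 0 ≤ y' x ^ 2 + (x ^ 2 / 4 - N) * y x ^ 2 := by positivity
    linarith
  refine antitoneOn_of_hasDerivAt_nonpos (convex_Ici a) (fun x _ => hsq x) (fun b hb => ?_)
  by_contra! hpos
  have hgrow : AntitoneOn (fun x => -(y x ^ 2)) (Set.Ici b) := by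
    refine antitoneOn_of_hasDerivAt_nonpos (convex_Ici b) (fun x _ => (hsq x).fun_neg)
      (fun x hx => ?_)
    have := hmono hb (Set.mem_Ici.2 (le_trans hb hx)) hx
    simp only at this
    linarith
  have hle : y b ^ 2 ≤ 0 := by
    have hl : Filter.Tendsto (fun x => y x ^ 2) Filter.atTop (nhds 0) := by
      simpa using hlim.pow 2
    refine ge_of_tendsto hl ?_
    filter_upwards [Filter.eventually_ge_atTop b] with x hx
    have := hgrow Set.self_mem_Ici hx hx
    simp only at this
    linarith
  have : y b = 0 := by nlinarith [sq_nonneg (y b)]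
  simp [this] at hpos

theorem weberAmplitude_le (hy : ∀ x, HasDerivAt y (y' x) x)
    (hy' : ∀ x, HasDerivAt y' (-(N - x ^ 2 / 4) * y x) x) {r K : ℝ} (hr : 1 ≤ r) (hN : N = r ^ 6)
    (hK : N * y 0 ^ 2 + y' 0 ^ 2 ≤ K * r ^ 3) {x : ℝ} (hx : 0 ≤ x) (hxr : r ^ 2 ≤ N - x ^ 2 / 4) :
    weberAmplitude x (waveNumber N x) (y x) (y' x) ≤ 3 * K := by
  have hr0 : 0 < r := by linarith
  have hs : ∀ t ∈ Set.Icc 0 x, r ≤ waveNumber N t := by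
    rintro t ⟨ht0, htx⟩
    exact Real.le_sqrt_of_sq_le (by nlinarith)
  have hlt : ∀ t ∈ Set.Icc 0 x, t ^ 2 / 4 < N := by
    rintro t ⟨ht0, htx⟩
    nlinarith
  have hanti : AntitoneOn (fun t => weberAmplitude t (waveNumber N t) (y t) (y' t) *
      Real.exp (-(reciprocalCurvature t (waveNumber N t) / (2 * r)))) (Set.Icc 0 x) := by
    refine antitoneOn_of_hasDerivAt_nonpos (convex_Icc 0 x) (fun t ht => ?_) (f' := fun t =>
      (9 * t / (16 * waveNumber N t ^ 5) + 15 * t ^ 3 / (64 * waveNumber N t ^ 7)) / 2 *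
      (y t ^ 2 - weberAmplitude t (waveNumber N t) (y t) (y' t) / r) *
      Real.exp (-(reciprocalCurvature t (waveNumber N t) / (2 * r)))) (fun t ht => ?_)
    · have h0 : waveNumber N t ≠ 0 := (hr0.trans_le (hs t ht)).ne'
      have hd := hasDerivAt_waveNumber (hlt t ht)
      have h1 := hasDerivAt_weberAmplitude hd h0 (hy t)
        (by rw [waveNumber_sq (hlt t ht).le]; exact hy' t)
      have h2 := (((hasDerivAt_reciprocalCurvature hd h0).div_const (2 * r)).fun_neg).exp
      refine (h1.fun_mul h2).congr_deriv ?_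
      field_simp
      ring
    · have ht0 := ht.1
      have hst := hs t ht
      have h0 : 0 < waveNumber N t := hr0.trans_le hst
      have h1 : y t ^ 2 ≤ weberAmplitude t (waveNumber N t) (y t) (y' t) / r := by
        rw [le_div_iff₀ hr0]
        refine le_trans ?_ (mul_sq_le_weberAmplitude h0)
        rw [mul_comm]
        gcongr
      refine mul_nonpos_of_nonpos_of_nonneg
        (mul_nonpos_of_nonneg_of_nonpos (by positivity) (by linarith)) (Real.exp_pos _).le
  have hK0 : 0 ≤ K := by
    have h3 : 0 < r ^ 3 := by positivity
    have : 0 ≤ K * r ^ 3 := le_trans (by rw [hN]; positivity) hK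
    exact nonneg_of_mul_nonneg_left this h3
  have hs0 : waveNumber N 0 = r ^ 3 := by
    rw [waveNumber, hN, show r ^ 6 - 0 ^ 2 / 4 = (r ^ 3) ^ 2 by ring]
    exact Real.sqrt_sq (by positivity)
  have hinit : weberAmplitude 0 (waveNumber N 0) (y 0) (y' 0) ≤ 9 / 8 * K := by
    rw [hs0, weberAmplitude_eq (by positivity)]
    have h1 : 1 / (8 * (r ^ 3) ^ 3) ≤ r ^ 3 / 8 := by
      rw [div_le_div_iff₀ (by positivity) (by norm_num)]
      have : 1 ≤ r ^ 12 := one_le_pow₀ hr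
      nlinarith
    have h2 : (N * y 0 ^ 2 + y' 0 ^ 2) / r ^ 3 ≤ K := by
      rw [div_le_iff₀ (by positivity)]; exact hK
    have h3 : (N * y 0 ^ 2 + y' 0 ^ 2) / r ^ 3 = r ^ 3 * y 0 ^ 2 + y' 0 ^ 2 / r ^ 3 := by
      rw [hN]; field_simp
    have h4 : 0 ≤ y' 0 ^ 2 / r ^ 3 := by positivity
    have h5 : 1 / (8 * (r ^ 3) ^ 3) * y 0 ^ 2 ≤ r ^ 3 / 8 * y 0 ^ 2 := by gcongr
    simp only [zero_div, zero_mul, sub_zero]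
    norm_num only [mul_zero, zero_div]
    nlinarith
  have hcurv : reciprocalCurvature x (waveNumber N x) / (2 * r) ≤ 1 / 2 := by
    have hsx := hs x ⟨hx, le_rfl⟩
    have hx2 : x ^ 2 ≤ 4 * r ^ 6 := by nlinarith
    calc reciprocalCurvature x (waveNumber N x) / (2 * r)
        ≤ (1 / (4 * r ^ 3) + 3 * (4 * r ^ 6) / (16 * r ^ 5)) / (2 * r) := by
          unfold reciprocalCurvature; gcongr
      _ = 1 / (8 * r ^ 4) + 3 / 8 := by field_simp; ring
      _ ≤ 1 / (8 * 1) + 3 / 8 := by gcongr; exact one_le_pow₀ hr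
      _ = 1 / 2 := by norm_num
  have hmain := hanti (Set.left_mem_Icc.2 hx) (Set.right_mem_Icc.2 hx) hx
  simp only at hmain
  have he0 : Real.exp (-(reciprocalCurvature 0 (waveNumber N 0) / (2 * r))) ≤ 1 := by
    rw [Real.exp_le_one_iff, hs0]
    unfold reciprocalCurvature
    have : 0 ≤ (1 / (4 * (r ^ 3) ^ 3) + 3 * 0 ^ 2 / (16 * (r ^ 3) ^ 5)) / (2 * r) := by positivity
    linarith
  have hex : 1 / 2 ≤ Real.exp (-(reciprocalCurvature x (waveNumber N x) / (2 * r))) := by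
    have := Real.add_one_le_exp (-(reciprocalCurvature x (waveNumber N x) / (2 * r)))
    linarith
  have hsx0 : 0 < waveNumber N x := hr0.trans_le (hs x ⟨hx, le_rfl⟩)
  have hA : 0 ≤ weberAmplitude x (waveNumber N x) (y x) (y' x) :=
    le_trans (by positivity) (mul_sq_le_weberAmplitude hsx0)
  have hA0 : 0 ≤ weberAmplitude 0 (waveNumber N 0) (y 0) (y' 0) :=
    le_trans (by rw [hs0]; positivity) (mul_sq_le_weberAmplitude (by rw [hs0]; positivity))
  have h1 := mul_le_mul_of_nonneg_left hex hA
  have h2 := mul_le_mul_of_nonneg_left he0 hA0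
  linarith

theorem sq_mul_le_of_weber (hy : ∀ x, HasDerivAt y (y' x) x)
    (hy' : ∀ x, HasDerivAt y' (-(N - x ^ 2 / 4) * y x) x)
    (hlim : Filter.Tendsto y Filter.atTop (nhds 0)) {r K : ℝ} (hr : 1 ≤ r) (hN : N = r ^ 6)
    (hK : N * y 0 ^ 2 + y' 0 ^ 2 ≤ K * r ^ 3) {x : ℝ} (hx : 0 ≤ x) :
    r * y x ^ 2 ≤ 100 * K := by
  have hr0 : 0 < r := by linarith
  have hK0 : 0 ≤ K := by
    have h3 : 0 < r ^ 3 := by positivity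
    have : 0 ≤ K * r ^ 3 := le_trans (by rw [hN]; positivity) hK
    exact nonneg_of_mul_nonneg_left this h3
  have hosc : ∀ t, 0 ≤ t → r ^ 2 ≤ N - t ^ 2 / 4 → r * y t ^ 2 ≤ 3 * K := by
    intro t ht htr
    have hs : r ≤ waveNumber N t := Real.le_sqrt_of_sq_le htr
    calc r * y t ^ 2 ≤ waveNumber N t * y t ^ 2 := by gcongr
      _ ≤ _ := mul_sq_le_weberAmplitude (hr0.trans_le hs)
      _ ≤ _ := weberAmplitude_le hy hy' hr hN hK ht htr
  have hr26 : r ^ 2 ≤ r ^ 6 := pow_le_pow_right₀ hr (by norm_num)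
  set x₀ := 2 * √(r ^ 6 - r ^ 2) with hx₀
  have hx₀0 : 0 ≤ x₀ := by positivity
  have hx₀sq : x₀ ^ 2 / 4 = r ^ 6 - r ^ 2 := by
    rw [hx₀, mul_pow, Real.sq_sqrt (by linarith)]; ring
  have hx₀r : N - x₀ ^ 2 / 4 = r ^ 2 := by rw [hx₀sq, hN]; ring
  have hs₀ : waveNumber N x₀ = r := by rw [waveNumber, hx₀r]; exact Real.sqrt_sq hr0.le
  have hx₀le : x₀ ≤ 2 * r ^ 3 := by
    refine le_of_sq_le_sq ?_ (by positivity)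
    nlinarith
  have hgap : (2 * r ^ 3 - x₀) * r ≤ 2 := by
    have h1 : (2 * r ^ 3 - x₀) * (2 * r ^ 3 + x₀) = 4 * r ^ 2 := by linarith
    have h2 : (2 * r ^ 3 - x₀) * (2 * r ^ 3) ≤ 4 * r ^ 2 := by
      rw [← h1]
      have : 0 ≤ 2 * r ^ 3 - x₀ := by linarith
      gcongr
      linarith
    have h3 : 0 < r ^ 2 := by positivity
    nlinarith
  have hy₀ := hosc x₀ hx₀0 hx₀r.ge
  have hy'₀ : y' x₀ ^ 2 ≤ 7 * K * r := by
    have h1 := weberAmplitude_le hy hy' hr hN hK hx₀0 hx₀r.ge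
    rw [hs₀] at h1
    have h2 := (sq_div_le_weberAmplitude hr0).trans h1
    rw [div_le_iff₀ hr0] at h2
    set z := x₀ / (8 * r ^ 2) * y x₀ with hz
    have h3 : x₀ / (8 * r ^ 2) ≤ r / 4 := by
      rw [div_le_div_iff₀ (by positivity) (by norm_num)]
      linarith
    have h4 : z ^ 2 ≤ (r / 4) ^ 2 * y x₀ ^ 2 := by
      rw [hz, mul_pow]; gcongr
    have h5 : (r / 4) ^ 2 * y x₀ ^ 2 ≤ 3 / 16 * K * r := by nlinarith
    nlinarith [sq_nonneg (y' x₀ - 2 * z)]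
  have hslope : ∀ t ∈ Set.Icc x₀ (2 * r ^ 3), y' t ^ 2 ≤ 10 * K * r := by
    rintro t ⟨ht0, ht1⟩
    have h := antitoneOn_weberEnergy hy hy' (Set.mem_Ici.2 hx₀0)
      (Set.mem_Ici.2 (hx₀0.trans ht0)) ht0
    simp only [hx₀r] at h
    have h1 : 0 ≤ N - t ^ 2 / 4 := by rw [hN]; nlinarith
    have h2 : 0 ≤ (N - t ^ 2 / 4) * y t ^ 2 := by positivity
    nlinarith
  have htrans : ∀ t ∈ Set.Icc x₀ (2 * r ^ 3), r * y t ^ 2 ≤ 100 * K := by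
    intro t ht
    have h := norm_image_sub_le_of_norm_deriv_le_segment' (f := y) (C := √(10 * K * r))
      (fun u _ => (hy u).hasDerivWithinAt)
      (fun u hu => Real.abs_le_sqrt (hslope u ⟨hu.1, hu.2.le⟩)) t ht
    have h1 : (y t - y x₀) ^ 2 ≤ (10 * K * r) * (t - x₀) ^ 2 := by
      rw [← Real.sq_sqrt (show 0 ≤ 10 * K * r by positivity), ← mul_pow]
      exact sq_le_sq' (by linarith [neg_le_of_abs_le h]) (le_of_abs_le h)
    have h2 : ((t - x₀) * r) ^ 2 ≤ 2 ^ 2 := by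
      have h3 := ht.1
      have h4 : (t - x₀) * r ≤ (2 * r ^ 3 - x₀) * r := by gcongr; exact ht.2
      have h5 : 0 ≤ (t - x₀) * r := mul_nonneg (by linarith) hr0.le
      gcongr
      linarith
    have h3 : r * (y t - y x₀) ^ 2 ≤ 40 * K := by
      calc r * (y t - y x₀) ^ 2 ≤ r * ((10 * K * r) * (t - x₀) ^ 2) := by gcongr
        _ = 10 * K * ((t - x₀) * r) ^ 2 := by ring
        _ ≤ 10 * K * 2 ^ 2 := by gcongr
        _ = 40 * K := by ring
    have h4 : r * y t ^ 2 ≤ r * (2 * (y t - y x₀) ^ 2 + 2 * y x₀ ^ 2) := by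
      gcongr
      nlinarith [sq_nonneg (y t - 2 * y x₀)]
    linarith
  rcases le_total x x₀ with h | h
  · have := hosc x hx (by rw [← hx₀r]; gcongr)
    linarith
  rcases le_total x (2 * r ^ 3) with h' | h'
  · exact htrans x ⟨h, h'⟩
  · have h1 := antitoneOn_sq_of_le_sq hy hy' hlim (a := 2 * r ^ 3) (by positivity)
      (by rw [hN]; ring_nf; rfl) Set.self_mem_Ici h' h'
    have h2 := htrans _ (Set.right_mem_Icc.2 hx₀le)
    refine le_trans ?_ h2
    gcongr

theorem sq_mul_exp_le_of_weber (hy : ∀ x, HasDerivAt y (y' x) x)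
    (hy' : ∀ x, HasDerivAt y' (-(N - x ^ 2 / 4) * y x) x)
    (hlim : Filter.Tendsto y Filter.atTop (nhds 0)) {r K : ℝ} (hr : 1 ≤ r) (hN : N = r ^ 6)
    (hK : N * y 0 ^ 2 + y' 0 ^ 2 ≤ K * r ^ 3) {x : ℝ} (hx : 0 ≤ x) :
    r ^ 3 * (y x * Real.exp (-(x ^ 2 / 4))) ^ 2 ≤ 100 * K := by
  have hr0 : 0 < r := by linarith
  have hsplit : r ^ 3 * (y x * Real.exp (-(x ^ 2 / 4))) ^ 2
      = r ^ 3 * y x ^ 2 * Real.exp (-(x ^ 2 / 2)) := by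
    rw [mul_pow, ← Real.exp_nat_mul, ← mul_assoc]
    congr 2
    push_cast
    ring
  rw [hsplit]
  have hbound := sq_mul_le_of_weber hy hy' hlim hr hN hK hx
  have hK0 : 0 ≤ K := by
    have : 0 ≤ r * y x ^ 2 := by positivity
    linarith
  rcases le_total (x ^ 2) (2 * N) with h | h
  · have h1 := antitoneOn_weberEnergy hy hy' Set.self_mem_Ici (Set.mem_Ici.2 hx) hx
    simp only at h1
    have h2 : N / 2 * y x ^ 2 ≤ (N - x ^ 2 / 4) * y x ^ 2 := by gcongr; linarith
    have h3 : r ^ 3 * y x ^ 2 ≤ 2 * K := by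
      have h4 : r ^ 3 * (r ^ 3 * y x ^ 2) ≤ r ^ 3 * (2 * K) := by
        rw [← mul_assoc, ← pow_add, ← hN]
        nlinarith [sq_nonneg (y' x)]
      exact le_of_mul_le_mul_left h4 (by positivity)
    have h5 : Real.exp (-(x ^ 2 / 2)) ≤ 1 := Real.exp_le_one_iff.2 (by nlinarith [sq_nonneg x])
    calc r ^ 3 * y x ^ 2 * Real.exp (-(x ^ 2 / 2)) ≤ 2 * K * 1 := by gcongr
      _ ≤ 100 * K := by linarith
  · have h1 : r ^ 2 * Real.exp (-(x ^ 2 / 2)) ≤ 1 := by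
      rw [Real.exp_neg, ← div_eq_mul_inv, div_le_one (Real.exp_pos _)]
      have h2 : r ^ 2 ≤ r ^ 6 := pow_le_pow_right₀ hr (by norm_num)
      have h3 := Real.add_one_le_exp (x ^ 2 / 2)
      linarith
    calc r ^ 3 * y x ^ 2 * Real.exp (-(x ^ 2 / 2))
        = r * y x ^ 2 * (r ^ 2 * Real.exp (-(x ^ 2 / 2))) := by ring
      _ ≤ 100 * K * 1 := by gcongr
      _ = 100 * K := by ring

end Weber

theorem hasDerivAt_hermite_mul_exp (n : ℕ) (x : ℝ) :
    HasDerivAt (fun x : ℝ => aeval x (hermite n) * Real.exp (-(x ^ 2 / 4)))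
      ((aeval x (derivative (hermite n)) - x / 2 * aeval x (hermite n)) *
        Real.exp (-(x ^ 2 / 4))) x := by
  refine (((hermite n).hasDerivAt_aeval x).fun_mul
    ((hasDerivAt_pow 2 x).div_const 4).fun_neg.exp).congr_deriv ?_
  push_cast
  ring

theorem hasDerivAt_derivative_hermite_mul_exp (n : ℕ) (x : ℝ) :
    HasDerivAt (fun x : ℝ => (aeval x (derivative (hermite n)) - x / 2 * aeval x (hermite n)) *
        Real.exp (-(x ^ 2 / 4)))
      (-((n : ℝ) + 1 / 2 - x ^ 2 / 4) * (aeval x (hermite n) * Real.exp (-(x ^ 2 / 4)))) x := by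
  refine ((((derivative (hermite n)).hasDerivAt_aeval x).fun_sub
    (((hasDerivAt_id' x).div_const 2).fun_mul ((hermite n).hasDerivAt_aeval x))).fun_mul
    ((hasDerivAt_pow 2 x).div_const 4).fun_neg.exp).congr_deriv ?_
  rw [derivative_derivative_hermite]
  simp only [map_sub, map_mul, aeval_X, map_natCast]
  push_cast
  ring

theorem tendsto_aeval_mul_exp_neg_sq (p : ℤ[X]) :
    Filter.Tendsto (fun x : ℝ => aeval x p * Real.exp (-(x ^ 2 / 4))) Filter.atTop (nhds 0) := by
  simpa only [eval_map_algebraMap] using tendsto_eval_mul_exp_neg_sq (p.map (algebraMap ℤ ℝ))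

theorem hermite_initial_energy_le {n : ℕ} (hn : 1 ≤ n) {r : ℝ} (hr : 1 ≤ r)
    (hN : (n : ℝ) + 1 / 2 = r ^ 6) :
    ((n : ℝ) + 1 / 2) * aeval (0 : ℝ) (hermite n) ^ 2 +
      aeval (0 : ℝ) (derivative (hermite n)) ^ 2 ≤ 2 * n.factorial * r ^ 3 := by
  obtain ⟨m, rfl⟩ := Nat.exists_eq_add_of_le' hn
  have hr3 : 0 < r ^ 3 := by positivity
  have h1 : ((m + 1 : ℕ) + 1 / 2 : ℝ) * aeval (0 : ℝ) (hermite (m + 1)) ^ 2 ≤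
      (m + 1).factorial * r ^ 3 := by
    have hle : r ^ 3 ≤ √((m + 1 : ℕ) + 1) := Real.le_sqrt_of_sq_le (by
      rw [← pow_mul, ← hN]; linarith)
    have := aeval_zero_hermite_sq_le (m + 1)
    calc ((m + 1 : ℕ) + 1 / 2 : ℝ) * aeval (0 : ℝ) (hermite (m + 1)) ^ 2
        = aeval (0 : ℝ) (hermite (m + 1)) ^ 2 * r ^ 3 * r ^ 3 := by rw [hN]; ring
      _ ≤ aeval (0 : ℝ) (hermite (m + 1)) ^ 2 * √((m + 1 : ℕ) + 1) * r ^ 3 := by gcongr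
      _ ≤ _ := by gcongr
  have h2 : aeval (0 : ℝ) (derivative (hermite (m + 1))) ^ 2 ≤ (m + 1).factorial * r ^ 3 := by
    have hle : √((m : ℝ) + 1) ≤ r ^ 3 := Real.sqrt_le_iff.2 ⟨hr3.le, by
      rw [← pow_mul, ← hN]; push_cast; linarith⟩
    have := aeval_zero_hermite_sq_le m
    have hsq : √((m : ℝ) + 1) ^ 2 = m + 1 := Real.sq_sqrt (by positivity)
    rw [derivative_hermite_succ, Nat.factorial_succ]
    simp only [map_mul, map_add, map_natCast, map_one]
    push_cast
    calc (((m : ℝ) + 1) * aeval (0 : ℝ) (hermite m)) ^ 2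
        = (m + 1) * (aeval (0 : ℝ) (hermite m) ^ 2 * √((m : ℝ) + 1) ^ 2) := by rw [hsq]; ring
      _ = (m + 1) * (aeval (0 : ℝ) (hermite m) ^ 2 * √((m : ℝ) + 1)) * √((m : ℝ) + 1) := by ring
      _ ≤ (m + 1) * m.factorial * r ^ 3 := by gcongr
  linarith

theorem hermite_mul_exp_bounds {n : ℕ} (hn : 1 ≤ n) {r : ℝ} (hr : 1 ≤ r)
    (hN : (n : ℝ) + 1 / 2 = r ^ 6) (x : ℝ) :
    r * (aeval x (hermite n) * Real.exp (-(x ^ 2 / 4))) ^ 2 ≤ 100 * (2 * n.factorial) ∧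
    r ^ 3 * (aeval x (hermite n) * Real.exp (-(x ^ 2 / 4)) * Real.exp (-(x ^ 2 / 4))) ^ 2 ≤
      100 * (2 * n.factorial) := by
  have hK := hermite_initial_energy_le hn hr hN
  rcases le_total 0 x with hx | hx
  · have hlim := tendsto_aeval_mul_exp_neg_sq (hermite n)
    exact ⟨sq_mul_le_of_weber (hasDerivAt_hermite_mul_exp n)
        (hasDerivAt_derivative_hermite_mul_exp n) hlim hr hN (by simpa using hK) hx,
      sq_mul_exp_le_of_weber (hasDerivAt_hermite_mul_exp n)
        (hasDerivAt_derivative_hermite_mul_exp n) hlim hr hN (by simpa using hK) hx⟩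
  · have hlim : Filter.Tendsto (fun x : ℝ => aeval (-x) (hermite n) *
        Real.exp (-((-x) ^ 2 / 4))) Filter.atTop (nhds 0) := by
      simpa [aeval_comp] using tendsto_aeval_mul_exp_neg_sq ((hermite n).comp (-X))
    have hy := fun x : ℝ =>
      (hasDerivAt_hermite_mul_exp n (-x)).scomp x (hasDerivAt_neg x)
    have hy' := fun x : ℝ =>
      ((hasDerivAt_derivative_hermite_mul_exp n (-x)).scomp x (hasDerivAt_neg x)).const_smul (-1 : ℝ)
    have hy'' : ∀ x : ℝ, HasDerivAt _ (-((n : ℝ) + 1 / 2 - x ^ 2 / 4) *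
        (aeval (-x) (hermite n) * Real.exp (-((-x) ^ 2 / 4)))) x := fun x =>
      (hy' x).congr_deriv (by simp)
    have hx' : 0 ≤ -x := by linarith
    have h1 := sq_mul_le_of_weber hy hy'' hlim hr hN (by simpa using hK) hx'
    have h2 := sq_mul_exp_le_of_weber hy hy'' hlim hr hN (by simpa using hK) hx'
    simp only [Function.comp_apply, neg_neg, even_two.neg_pow] at h1 h2
    exact ⟨h1, h2⟩

theorem le_fifteen_mul_of_pow_mul_sq_le {n k : ℕ} (hn : 1 ≤ n) {a F : ℝ} (hF : 0 ≤ F)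
    (h : (((n : ℝ) + 1 / 2) ^ (1 / 6 : ℝ)) ^ k * a ^ 2 ≤ 100 * (2 * F)) :
    |a| ≤ 15 * √F * (n : ℝ) ^ (-(k : ℝ) / 12) := by
  have hn0 : (0 : ℝ) < n := by exact_mod_cast hn
  refine abs_le_of_sq_le_sq ?_ (by positivity)
  have h1 : ((n : ℝ) ^ (-(k : ℝ) / 12)) ^ 2 * ((n : ℝ) ^ (1 / 6 : ℝ)) ^ k = 1 := by
    rw [← Real.rpow_mul_natCast hn0.le, ← Real.rpow_mul_natCast hn0.le, ← Real.rpow_add hn0]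
    convert Real.rpow_zero _ using 2
    push_cast
    ring
  have h2 : ((n : ℝ) ^ (1 / 6 : ℝ)) ^ k * a ^ 2 ≤ 225 * F := by
    calc ((n : ℝ) ^ (1 / 6 : ℝ)) ^ k * a ^ 2
        ≤ (((n : ℝ) + 1 / 2) ^ (1 / 6 : ℝ)) ^ k * a ^ 2 := by gcongr; linarith
      _ ≤ 225 * F := by linarith
  calc a ^ 2 = ((n : ℝ) ^ (-(k : ℝ) / 12)) ^ 2 * (((n : ℝ) ^ (1 / 6 : ℝ)) ^ k * a ^ 2) := by
        rw [← mul_assoc, h1, one_mul]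
    _ ≤ ((n : ℝ) ^ (-(k : ℝ) / 12)) ^ 2 * (225 * F) := by gcongr
    _ = (15 * √F * (n : ℝ) ^ (-(k : ℝ) / 12)) ^ 2 := by
        rw [mul_pow, mul_pow, Real.sq_sqrt hF]; ring

/-- For every `α ∈ [1/4, 1/2]` there is `c > 0` such that for all `n ≥ 1`,
`sup_x |H_n(x) e^{-αx²}| ≤ c √(n!) n^{-(8α-1)/12}`, where `H_n` is the probabilists'
Hermite polynomial. -/
theorem stmt18 (α : ℝ) (hα : α ∈ Set.Icc (1/4 : ℝ) (1/2)) :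
    ∃ c : ℝ, 0 < c ∧ ∀ n : ℕ, 1 ≤ n → ∀ x : ℝ,
      |(Polynomial.aeval x (Polynomial.hermite n) : ℝ) * Real.exp (-α * x ^ 2)|
        ≤ c * Real.sqrt (n.factorial) * (n : ℝ) ^ (-(8 * α - 1) / 12) := by
  obtain ⟨hα1, hα2⟩ := hα
  refine ⟨15, by norm_num, fun n hn x => ?_⟩
  have hn0 : (0 : ℝ) < n := by exact_mod_cast hn
  set r : ℝ := ((n : ℝ) + 1 / 2) ^ (1 / 6 : ℝ) with hr
  have hr1 : 1 ≤ r := Real.one_le_rpow (by linarith [show (1 : ℝ) ≤ n by exact_mod_cast hn])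
    (by norm_num)
  have hN : (n : ℝ) + 1 / 2 = r ^ 6 := by
    rw [hr, ← Real.rpow_mul_natCast (by positivity)]
    norm_num
  obtain ⟨hA, hB⟩ := hermite_mul_exp_bounds hn hr1 hN x
  have hF : (0 : ℝ) ≤ n.factorial := Nat.cast_nonneg _
  have hA' := le_fifteen_mul_of_pow_mul_sq_le (k := 1) hn hF (by simpa [hr] using hA)
  have hB' := le_fifteen_mul_of_pow_mul_sq_le (k := 3) hn hF hB
  set y := aeval x (hermite n) * Real.exp (-(x ^ 2 / 4)) with hy
  set M : ℝ := 15 * √n.factorial with hM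
  have hM0 : 0 < M := by
    have : (0 : ℝ) < n.factorial := by exact_mod_cast n.factorial_pos
    positivity
  set θ := 4 * α - 1 with hθ
  have hθ0 : 0 ≤ θ := by linarith
  have hθ1 : 0 ≤ 1 - θ := by linarith
  have hsplit : |aeval x (hermite n) * Real.exp (-α * x ^ 2)| =
      |y| ^ (1 - θ) * |y * Real.exp (-(x ^ 2 / 4))| ^ θ := by
    rw [abs_mul y, Real.abs_exp, Real.mul_rpow (abs_nonneg _) (Real.exp_pos _).le, ← mul_assoc,
      ← Real.rpow_add_of_nonneg (abs_nonneg _) hθ1 hθ0, sub_add_cancel, Real.rpow_one, ← Real.exp_mul,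
      hy, abs_mul, abs_mul, Real.abs_exp, Real.abs_exp, mul_assoc, ← Real.exp_add]
    congr 2
    rw [hθ]
    ring
  rw [hsplit]
  calc |y| ^ (1 - θ) * |y * Real.exp (-(x ^ 2 / 4))| ^ θ
      ≤ (M * (n : ℝ) ^ (-((1 : ℕ) : ℝ) / 12)) ^ (1 - θ) *
        (M * (n : ℝ) ^ (-((3 : ℕ) : ℝ) / 12)) ^ θ := by gcongr
    _ = (M ^ (1 - θ) * M ^ θ) * ((n : ℝ) ^ (-((1 : ℕ) : ℝ) / 12 * (1 - θ)) *
        (n : ℝ) ^ (-((3 : ℕ) : ℝ) / 12 * θ)) := by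
        rw [Real.mul_rpow hM0.le (by positivity), Real.mul_rpow hM0.le (by positivity),
          ← Real.rpow_mul hn0.le, ← Real.rpow_mul hn0.le]
        ring
    _ = M * (n : ℝ) ^ (-(8 * α - 1) / 12) := by
        rw [← Real.rpow_add hM0, ← Real.rpow_add hn0, sub_add_cancel, Real.rpow_one]
        congr 2
        rw [hθ]
        push_cast
        ring
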